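/- Let V = (Q, Σ, Δ) be a 2-TVASS. Write c →^{A*∪T} c' if there is a run from c to c' whose path is either a single zero-test transition or contains no zero-test transition. For all configurations p(x⃗) and q(y⃗) with p(x⃗) →* q(y⃗), either p(x⃗) →^π q(y⃗) for some path π containing no zero-test transition, or there exist k with 1 ≤ k ≤ |Q|, states q₁, …, q_k ∈ Q and naturals x₁, y₁, …, x_k, y_k ∈ ℕ such that: p(x⃗) →^{A*∪T} q₁(0, x₁); q_j(0, x_j) →* q_j(0, y_j) for every j ∈ {1,…,k}; q_j(0, y_j) →^{A*∪T} q_{j+1}(0, x_{j+1}) for every j ∈ {1,…,k−1}; and q_k(0, y_k) →^{A*∪T} q(y⃗). -/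

import Mathlib

namespace TVASSpaper

/-- Actions of a `d`-TVASS: `some a` is an addition of the vector `a ∈ ℤ^d`,
    `none` is the zero-test action `tst` (on the first counter). -/
abbrev Act (d : ℕ) := Option (Fin d → ℤ)

/-- Transitions. -/
abbrev Trans (d : ℕ) (Q : Type) := Q × Act d × Q

/-- Configurations: a state together with a vector of `d` counters. -/
abbrev Config (d : ℕ) (Q : Type) := Q × (Fin d → ℕ)

/-- A `d`-TVASS: a finite set `acts` of actions and a finite set of transitions
    `trans ⊆ Q × acts × Q`. The state set `Q` is a (finite, nonempty) type. -/
structure TVASS (d : ℕ) (Q : Type) where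
  acts : Finset (Act d)
  trans : Finset (Trans d Q)
  mem_acts : ∀ t ∈ trans, t.2.1 ∈ acts

variable {d : ℕ} {Q : Type}

/-- The step induced by a single transition: an addition transition `(p, a, q)`
    induces `p(x) → q(x + a)` whenever `x + a ∈ ℕ^d`; a zero-test transition
    `(p, tst, q)` induces `p(x) → q(x)` whenever the first counter is `0`. -/
def StepBy [NeZero d] (t : Trans d Q) (c c' : Config d Q) : Prop :=
  t.1 = c.1 ∧ t.2.2 = c'.1 ∧
    match t.2.1 with
    | some a => ∀ i, (c'.2 i : ℤ) = (c.2 i : ℤ) + a i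
    | none => c.2 0 = 0 ∧ c'.2 = c.2

/-- `Run V c π c'` : there is a run from `c` to `c'` taking the steps of the
    word of transitions `π` in order. -/
inductive Run [NeZero d] (V : TVASS d Q) :
    Config d Q → List (Trans d Q) → Config d Q → Prop
  | nil (c : Config d Q) : Run V c [] c
  | cons {t : Trans d Q} {c c' c'' : Config d Q} {π : List (Trans d Q)} :
      t ∈ V.trans → StepBy t c c' → Run V c' π c'' → Run V c (t :: π) c''

/-- One step of the TVASS. -/
def Step [NeZero d] (V : TVASS d Q) (c c' : Config d Q) : Prop :=
  ∃ t ∈ V.trans, StepBy t c c'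

/-- Reachability `c →* c'`. -/
def Reach [NeZero d] (V : TVASS d Q) (c c' : Config d Q) : Prop :=
  ∃ π, Run V c π c'

/-- `IsPathFrom V p π q` : `π` is a path (word of transitions of `V` with
    matching endpoints) from state `p` to state `q`. -/
inductive IsPathFrom (V : TVASS d Q) : Q → List (Trans d Q) → Q → Prop
  | nil (p : Q) : IsPathFrom V p [] p
  | cons {t : Trans d Q} {π : List (Trans d Q)} {q : Q} :
      t ∈ V.trans → IsPathFrom V t.2.2 π q → IsPathFrom V t.1 (t :: π) q

/-- `n`-fold concatenation of a word. -/
def pw {α : Type*} (l : List α) (n : ℕ) : List α := (List.replicate n l).flatten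

/-- A linear path scheme `α₀ β₁* α₁ ⋯ β_k* α_k`, given by the head path `α₀`
    and the list of pairs `(β₁, α₁), …, (β_k, α_k)`. -/
structure LPS (d : ℕ) (Q : Type) where
  head : List (Trans d Q)
  rest : List (List (Trans d Q) × List (Trans d Q))

/-- Length `|L|` of a linear path scheme. -/
def LPS.len (L : LPS d Q) : ℕ :=
  L.head.length + (L.rest.map fun p => p.1.length + p.2.length).sum

/-- Number of stars `|L|_*` of a linear path scheme. -/
def LPS.stars (L : LPS d Q) : ℕ := L.rest.length

def wordRest : List (List (Trans d Q) × List (Trans d Q)) → List ℕ → List (Trans d Q)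
  | [], _ => []
  | p :: rest, ns => pw p.1 (ns.headD 0) ++ p.2 ++ wordRest rest ns.tail

/-- The word `α₀ β₁^{n₁} α₁ ⋯ β_k^{n_k} α_k` of `L` for exponents `ns`. -/
def LPS.word (L : LPS d Q) (ns : List ℕ) : List (Trans d Q) :=
  L.head ++ wordRest L.rest ns

/-- Well-formedness of the tail of a linear path scheme starting in state `s`:
    the `βᵢ` are cycles and the `αᵢ` are paths, with matching endpoints. -/
inductive ChainLPS (V : TVASS d Q) :
    Q → List (List (Trans d Q) × List (Trans d Q)) → Q → Prop
  | nil (q : Q) : ChainLPS V q [] q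
  | cons {s s' q : Q} {β α : List (Trans d Q)}
      {rest : List (List (Trans d Q) × List (Trans d Q))} :
      IsPathFrom V s β s → IsPathFrom V s α s' → ChainLPS V s' rest q →
      ChainLPS V s ((β, α) :: rest) q

/-- `L` is a genuine linear path scheme from `p` to `q` in `V`. -/
def IsLPS (V : TVASS d Q) (p : Q) (L : LPS d Q) (q : Q) : Prop :=
  ∃ s, IsPathFrom V p L.head s ∧ ChainLPS V s L.rest q

/-- `c →^L c'` : reachability along the linear path scheme `L`. -/
def ReachLPS [NeZero d] (V : TVASS d Q) (L : LPS d Q) (c c' : Config d Q) : Prop :=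
  ∃ ns, Run V c (L.word ns) c'

/-- `‖x⃗‖`: maximum component of a vector of naturals. -/
def vnorm {d : ℕ} (v : Fin d → ℕ) : ℕ := Finset.univ.sup v

/-- Maximum absolute value of a component of an integer vector. -/
def vnormZ {d : ℕ} (v : Fin d → ℤ) : ℕ := Finset.univ.sup fun i => (v i).natAbs

/-- `‖Σ‖`: maximum absolute value of a component of a vector in `Σ ∖ {tst}`
    (0 if `Σ ⊆ {tst}`). -/
def TVASS.actNorm (V : TVASS d Q) : ℕ :=
  V.acts.sup fun a => a.elim 0 vnormZ

/-- Displacement of a word of transitions (zero-tests contribute `0`). -/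
def disp (π : List (Trans d Q)) : Fin d → ℤ :=
  fun i => (π.map fun t => (t.2.1.elim 0 id : Fin d → ℤ) i).sum

/-- `m_π(i)`: max over prefixes `α` of `π` (including the empty prefix) of `-Δ(α)(i)`. -/
def mpre (π : List (Trans d Q)) (i : Fin d) : ℤ :=
  (π.inits.map fun α => -(disp α i)).foldr max 0

/-- `m_π̄(i)`: max over suffixes `σ` of `π` (including the empty suffix) of `Δ(σ)(i)`. -/
def msuf (π : List (Trans d Q)) (i : Fin d) : ℤ :=
  (π.tails.map fun σ => disp σ i).foldr max 0

/-- `π` contains no zero-test transition. -/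
def noTst (π : List (Trans d Q)) : Prop := ∀ t ∈ π, t.2.1 ≠ none

/-- `x⃗ ≥₁ m⃗` : `x⃗(1) = m⃗(1)` and `x⃗(i) ≥ m⃗(i)` for all other `i`. -/
def ge1 [NeZero d] (x : Fin d → ℕ) (m : Fin d → ℤ) : Prop :=
  (x 0 : ℤ) = m 0 ∧ ∀ i : Fin d, i ≠ 0 → m i ≤ (x i : ℤ)

/-- A path from `p` to `q` is feasible if some run takes it. -/
def Feasible [NeZero d] (V : TVASS d Q) (p : Q) (π : List (Trans d Q)) (q : Q) : Prop :=
  ∃ x y, Run V (p, x) π (q, y)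

/-- `c →^{A* ∪ T} c'` : there is a run from `c` to `c'` whose path either
    contains no zero-test transition, or is a single zero-test transition. -/
def ReachAT [NeZero d] (V : TVASS d Q) (c c' : Config d Q) : Prop :=
  ∃ π, Run V c π c' ∧ (noTst π ∨ ∃ t : Trans d Q, π = [t] ∧ t.2.1 = none)

/-- `p ⇝ q` for a 2-TVASS: `p(0, x) →* q(0, y)` for some `x, y ∈ ℕ`. -/
def Leads (V : TVASS 2 Q) (p q : Q) : Prop :=
  ∃ x y : ℕ, Reach V (p, ![0, x]) (q, ![0, y])

/-- The linear path scheme `L` is bounded from the configuration `c`: the set of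
    configurations reachable from `c` along a prefix of a path in `L` is finite. -/
def BoundedLPS [NeZero d] (V : TVASS d Q) (L : LPS d Q) (c : Config d Q) : Prop :=
  {c' : Config d Q | ∃ ns ρ, ρ <+: L.word ns ∧ Run V c ρ c'}.Finite


theorem Run.append [NeZero d] {V : TVASS d Q} {c c' c'' : Config d Q}
    {π ρ : List (Trans d Q)} (h : Run V c π c') (h' : Run V c' ρ c'') :
    Run V c (π ++ ρ) c'' := by
  induction h with
  | nil => exact h'
  | cons ht hs _ ih => exact Run.cons ht hs (ih h')

theorem Reach.refl [NeZero d] (V : TVASS d Q) (c : Config d Q) : Reach V c c :=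
  ⟨[], Run.nil c⟩

theorem Reach.trans [NeZero d] {V : TVASS d Q} {c c' c'' : Config d Q}
    (h : Reach V c c') (h' : Reach V c' c'') : Reach V c c'' := by
  obtain ⟨π, hπ⟩ := h
  obtain ⟨ρ, hρ⟩ := h'
  exact ⟨π ++ ρ, hπ.append hρ⟩

theorem ReachAT.reach [NeZero d] {V : TVASS d Q} {c c' : Config d Q}
    (h : ReachAT V c c') : Reach V c c' := by
  obtain ⟨π, hπ, -⟩ := h
  exact ⟨π, hπ⟩

/-- `c'` is reachable from `r(0, a)` by alternating loops at pairwise distinct states, between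
configurations whose first counter is `0`, and `→^{A* ∪ T}` steps. -/
def LoopChain (V : TVASS 2 Q) (r : Q) (a : ℕ) (c' : Config 2 Q) : Prop :=
  ∃ k : ℕ, 1 ≤ k ∧ ∃ (qs : ℕ → Q) (xs ys : ℕ → ℕ),
    Set.InjOn qs (Set.Iio k) ∧ qs 0 = r ∧ xs 0 = a ∧
    (∀ j < k, Reach V (qs j, ![0, xs j]) (qs j, ![0, ys j])) ∧
    (∀ j, j + 1 < k → ReachAT V (qs j, ![0, ys j]) (qs (j + 1), ![0, xs (j + 1)])) ∧
    ReachAT V (qs (k - 1), ![0, ys (k - 1)]) c'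

theorem LoopChain.single {V : TVASS 2 Q} {r : Q} {a : ℕ} {c' : Config 2 Q}
    (h : ReachAT V (r, ![0, a]) c') : LoopChain V r a c' := by
  refine ⟨1, le_rfl, fun _ => r, fun _ => a, fun _ => a, ?_, rfl, rfl,
    fun _ _ => Reach.refl V _, fun j hj => by omega, h⟩
  intro i hi j hj _
  simp only [Set.mem_Iio] at hi hj
  omega

theorem LoopChain.cons {V : TVASS 2 Q} {r s : Q} {a b : ℕ} {c' : Config 2 Q}
    (h : ReachAT V (r, ![0, a]) (s, ![0, b])) (hc : LoopChain V s b c') :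
    LoopChain V r a c' := by
  obtain ⟨k, hk, qs, xs, ys, hinj, rfl, rfl, hloop, hlink, hend⟩ := hc
  by_cases hr : ∃ j < k, qs j = r
  · obtain ⟨j, hj, rfl⟩ := hr
    have hreach : ∀ i < k, Reach V (qs j, ![0, a]) (qs i, ![0, xs i]) := by
      intro i
      induction i with
      | zero => exact fun _ => h.reach
      | succ i ih =>
        exact fun hi => ((ih (by omega)).trans (hloop i (by omega))).trans (hlink i hi).reach
    refine ⟨k - j, by omega, fun n => qs (n + j), fun n => if n = 0 then a else xs (n + j),
      fun n => ys (n + j), ?_, by simp, by simp, ?_, ?_, ?_⟩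
    · intro m hm n hn hmn
      simp only [Set.mem_Iio] at hm hn
      have := hinj (Set.mem_Iio.2 (by omega)) (Set.mem_Iio.2 (by omega)) hmn
      omega
    · intro n hn
      rcases n with _ | n
      · simpa using (hreach j hj).trans (hloop j hj)
      · simpa using hloop (n + 1 + j) (by omega)
    · intro n hn
      have := hlink (n + j) (by omega)
      rw [show n + j + 1 = n + 1 + j by omega] at this
      simpa using this
    · beta_reduce
      rw [show k - j - 1 + j = k - 1 by omega]
      exact hend
  · push Not at hr
    refine ⟨k + 1, by omega, fun n => Nat.casesOn n r qs, fun n => Nat.casesOn n a xs,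
      fun n => Nat.casesOn n a ys, ?_, rfl, rfl, ?_, ?_, ?_⟩
    · intro m hm n hn hmn
      simp only [Set.mem_Iio] at hm hn
      rcases m with _ | m <;> rcases n with _ | n
      · rfl
      · exact absurd hmn.symm (hr n (by omega))
      · exact absurd hmn (hr m (by omega))
      · exact congrArg (· + 1)
          (hinj (Set.mem_Iio.2 (by omega)) (Set.mem_Iio.2 (by omega)) hmn)
    · rintro (_ | n) hn
      · exact Reach.refl V _
      · exact hloop n (by omega)
    · rintro (_ | n) hn
      · exact h
      · exact hlink n (by omega)
    · obtain ⟨k, rfl⟩ := Nat.exists_eq_add_of_le' hk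
      exact hend

theorem Run.noTst_or_loopChain {V : TVASS 2 Q} {c c' : Config 2 Q} {π : List (Trans 2 Q)}
    (h : Run V c π c') :
    (∃ ρ, noTst ρ ∧ Run V c ρ c') ∨
      ∃ r a ρ, noTst ρ ∧ Run V c ρ (r, ![0, a]) ∧ LoopChain V r a c' := by
  induction h with
  | nil c => exact Or.inl ⟨[], by simp [noTst], Run.nil c⟩
  | @cons t c₁ c₂ c₃ π ht hs _ ih =>
    by_cases htst : t.2.1 = none
    · obtain ⟨r, x⟩ := c₁
      obtain ⟨s, y⟩ := c₂
      have hxy : x 0 = 0 ∧ y = x := by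
        have := hs.2.2
        rwa [htst] at this
      obtain ⟨hx, rfl⟩ := hxy
      have hy : y = ![0, y 1] := by
        ext i
        fin_cases i
        · exact hx
        · rfl
      have hstep : ReachAT V (r, ![0, y 1]) (s, ![0, y 1]) := by
        rw [← hy]
        exact ⟨[t], Run.cons ht hs (Run.nil _), Or.inr ⟨t, rfl, htst⟩⟩
      refine Or.inr ⟨r, y 1, [], by simp [noTst], ?_, LoopChain.cons hstep ?_⟩
      · rw [← hy]
        exact Run.nil _
      · rw [hy] at ih
        rcases ih with ⟨ρ, hρ, hrun⟩ | ⟨u, b, ρ, hρ, hrun, hchain⟩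
        · exact LoopChain.single ⟨ρ, hrun, Or.inl hρ⟩
        · exact LoopChain.cons ⟨ρ, hrun, Or.inl hρ⟩ hchain
    · have hcons : ∀ {ρ}, noTst ρ → noTst (t :: ρ) := fun hρ =>
        List.forall_mem_cons.2 ⟨htst, hρ⟩
      rcases ih with ⟨ρ, hρ, hrun⟩ | ⟨u, b, ρ, hρ, hrun, hchain⟩
      · exact Or.inl ⟨t :: ρ, hcons hρ, Run.cons ht hs hrun⟩
      · exact Or.inr ⟨u, b, t :: ρ, hcons hρ, Run.cons ht hs hrun, hchain⟩

/-- Lemma: from vertical-loop flatness to flatness. -/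
theorem vloop_flatness_to_flatness (Q : Type) [Fintype Q] [Nonempty Q]
    (V : TVASS 2 Q) (p q : Q) (xv yv : Fin 2 → ℕ)
    (h : Reach V (p, xv) (q, yv)) :
    (∃ π, noTst π ∧ Run V (p, xv) π (q, yv)) ∨
    ∃ k : ℕ, 1 ≤ k ∧ k ≤ Fintype.card Q ∧
      ∃ (qs : ℕ → Q) (xs ys : ℕ → ℕ),
        ReachAT V (p, xv) (qs 0, ![0, xs 0]) ∧
        (∀ j < k, Reach V (qs j, ![0, xs j]) (qs j, ![0, ys j])) ∧
        (∀ j, j + 1 < k →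
          ReachAT V (qs j, ![0, ys j]) (qs (j + 1), ![0, xs (j + 1)])) ∧
        ReachAT V (qs (k - 1), ![0, ys (k - 1)]) (q, yv) := by
  obtain ⟨π, hπ⟩ := h
  rcases hπ.noTst_or_loopChain with hfree | ⟨r, a, ρ, hρ, hrun, hchain⟩
  · exact Or.inl hfree
  · obtain ⟨k, hk, qs, xs, ys, hinj, rfl, rfl, hloop, hlink, hend⟩ := hchain
    refine Or.inr ⟨k, hk, ?_, qs, xs, ys, ⟨ρ, hrun, Or.inl hρ⟩, hloop, hlink, hend⟩
    have hcard := Finset.card_le_card_of_injOn (s := Finset.range k) (t := Finset.univ) qs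
      (fun _ _ => Finset.mem_coe.2 (Finset.mem_univ _)) (by simpa using hinj)
    simpa using hcard

end TVASSpaper
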